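/- Smoothness along transport interpolations: let φ: P₂(ℝ^d) → ℝ be Wasserstein differentiable at every measure, with (μ,ζ) ↦ D_μφ[μ](ζ) continuous, let μ* ∈ P_c(ℝ^d) and w ∈ L^∞(ℝ^d,ℝ^d;μ*), and set μ^θ = (Id + θw)_#μ* for θ ∈ [0,1]. Then the function Φ(θ) := φ(μ^θ) is continuously differentiable on [0,1] with derivative Φ'(θ) = ∫_{ℝ^d} D_μφ[μ^θ](ζ + θw(ζ)) · w(ζ) dμ*(ζ). -/

import Mathlib

/-!
Common definitions: 2-Wasserstein distance, compactly supported probability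
measures, the coupled PDE–ODE control system of sparse mean-field control
(weak measure solutions, non-local flows), Wasserstein differentiability,
the linearized operators and their adjoints.
-/

open MeasureTheory Set Metric Filter
open scoped RealInnerProductSpace ENNReal Topology

noncomputable section

/-- Euclidean space `ℝ^n`. -/
abbrev Rd (n : ℕ) : Type := EuclideanSpace ℝ (Fin n)

namespace WC

/-! ### Optimal transport basics -/

/-- `γ` is a coupling of `μ` and `ν`. -/
def IsCoupling {n : ℕ} (γ : Measure (Rd n × Rd n)) (μ ν : Measure (Rd n)) : Prop :=
  γ.fst = μ ∧ γ.snd = ν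

/-- Square-root of the quadratic transport cost of a coupling. -/
def transportCost {n : ℕ} (γ : Measure (Rd n × Rd n)) : ℝ :=
  Real.sqrt (∫ p, ‖p.1 - p.2‖ ^ 2 ∂γ)

/-- The 2-Wasserstein distance. -/
def W2 {n : ℕ} (μ ν : Measure (Rd n)) : ℝ :=
  sInf { r : ℝ | ∃ γ : Measure (Rd n × Rd n), IsCoupling γ μ ν ∧ r = transportCost γ }

/-- `γ` is an optimal coupling of `μ` and `ν`. -/
def IsOptCoupling {n : ℕ} (γ : Measure (Rd n × Rd n)) (μ ν : Measure (Rd n)) : Prop :=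
  IsCoupling γ μ ν ∧ transportCost γ = W2 μ ν

/-- `Tm` is an optimal transport map from `μ` to `ν`. -/
def IsOptimalTransportMap {n : ℕ} (Tm : Rd n → Rd n) (μ ν : Measure (Rd n)) : Prop :=
  Measurable Tm ∧ Measure.map Tm μ = ν ∧
    Real.sqrt (∫ x, ‖x - Tm x‖ ^ 2 ∂μ) = W2 μ ν

/-- Probability measures with finite second moment. -/
def IsP2 {n : ℕ} (μ : Measure (Rd n)) : Prop :=
  IsProbabilityMeasure μ ∧ Integrable (fun x => ‖x‖ ^ 2) μ

/-- Compactly supported probability measures. -/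
def IsPc {n : ℕ} (μ : Measure (Rd n)) : Prop :=
  IsProbabilityMeasure μ ∧ ∃ R : ℝ, μ (closedBall (0 : Rd n) R)ᶜ = 0

/-- The radius `m_∞(μ)` of the support of `μ`. -/
def mSupp {n : ℕ} (μ : Measure (Rd n)) : ℝ :=
  sInf { R : ℝ | 0 ≤ R ∧ μ (closedBall (0 : Rd n) R)ᶜ = 0 }

/-- A function into `ℝ^n` is (uniformly) bounded. -/
def BddFun {α : Type*} {n : ℕ} (f : α → Rd n) : Prop := ∃ B : ℝ, ∀ a, ‖f a‖ ≤ B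

/-! ### Wasserstein differentiability -/

/-- Membership in the tangent space `Tan_μ P₂(ℝ^n)`: `ξ` lies in the `L²(μ)`-closure of
gradients of smooth compactly supported functions. -/
def InTangent {n : ℕ} (μ : Measure (Rd n)) (ξ : Rd n → Rd n) : Prop :=
  ∀ ε > (0 : ℝ), ∃ ψ : Rd n → ℝ, ContDiff ℝ (⊤ : ℕ∞) ψ ∧ HasCompactSupport ψ ∧
    ∫ x, ‖ξ x - gradient ψ x‖ ^ 2 ∂μ < ε

/-- `φ : P₂(ℝ^n) → ℝ` is Wasserstein differentiable at `μ` with Wasserstein gradient `ξ`: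
`ξ` is tangent at `μ` and a first-order expansion along optimal couplings holds. -/
def HasWGradAt {n : ℕ} (φ : Measure (Rd n) → ℝ) (μ : Measure (Rd n)) (ξ : Rd n → Rd n) :
    Prop :=
  InTangent μ ξ ∧
  ∀ ε > (0 : ℝ), ∃ δ > (0 : ℝ), ∀ ν : Measure (Rd n), IsP2 ν →
    ∀ γ : Measure (Rd n × Rd n), IsOptCoupling γ μ ν → W2 μ ν < δ →
      |φ ν - φ μ - ∫ p, ⟪ξ p.1, p.2 - p.1⟫ ∂γ| ≤ ε * W2 μ ν

/-! ### The coupled PDE–ODE control system -/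

variable {d c : ℕ}

/-- Assumption (LIP): Lipschitz continuity of the fields `F` and `G`. -/
def LIP (F : Measure (Rd d) → Rd d → Rd c → Rd d)
    (G : Measure (Rd d) → Rd c → Rd c) (L : ℝ) : Prop :=
  0 < L ∧
  (∀ μ₁ μ₂ : Measure (Rd d), IsPc μ₁ → IsPc μ₂ → ∀ x₁ x₂ : Rd d, ∀ y₁ y₂ : Rd c,
    ‖F μ₁ x₁ y₁ - F μ₂ x₂ y₂‖ ≤ L * (‖x₁ - x₂‖ + (W2 μ₁ μ₂ + ‖y₁ - y₂‖))) ∧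
  (∀ μ₁ μ₂ : Measure (Rd d), IsPc μ₁ → IsPc μ₂ → ∀ y₁ y₂ : Rd c,
    ‖G μ₁ y₁ - G μ₂ y₂‖ ≤ L * (W2 μ₁ μ₂ + ‖y₁ - y₂‖))

/-- Assumption (SLG): sublinear growth of the fields `F` and `G`. -/
def SLG (F : Measure (Rd d) → Rd d → Rd c → Rd d)
    (G : Measure (Rd d) → Rd c → Rd c) (C : ℝ) : Prop :=
  0 < C ∧
  (∀ μ : Measure (Rd d), IsPc μ → ∀ (x : Rd d) (y : Rd c),
    ‖F μ x y‖ ≤ C * (1 + ‖x‖ + ‖y‖ + mSupp μ)) ∧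
  (∀ μ : Measure (Rd d), IsPc μ → ∀ y : Rd c,
    ‖G μ y‖ ≤ C * (1 + ‖y‖ + mSupp μ))

section Control

variable {Y : Type*} [NormedAddCommGroup Y] [NormedSpace ℝ Y] [CompleteSpace Y]

/-- Admissible controls: measurable and with values in `U` on `[0,T]`. -/
def AdmissibleControl [MeasurableSpace Y] (T : ℝ) (U : Set Y) (u : ℝ → Y) : Prop :=
  Measurable u ∧ ∀ t ∈ Icc (0 : ℝ) T, u t ∈ U

/-- Weak measure solution of the coupled PDE–ODE system
`∂ₜμ + ∇ₓ·(F[μ](·,y) μ) = 0`, `ẏ = G[μ](y) + u` on `[0,T]`. -/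
structure IsWeakSolution (T : ℝ) (F : Measure (Rd d) → Rd d → Y → Rd d)
    (G : Measure (Rd d) → Y → Y) (u : ℝ → Y)
    (μ : ℝ → Measure (Rd d)) (y : ℝ → Y) : Prop where
  /-- each `μ t` is a probability measure -/
  prob : ∀ t ∈ Icc (0 : ℝ) T, IsProbabilityMeasure (μ t)
  /-- the measures are equi-compactly supported -/
  equiSupp : ∃ R : ℝ, 0 < R ∧ ∀ t ∈ Icc (0 : ℝ) T, (μ t) (closedBall (0 : Rd d) R)ᶜ = 0
  /-- the continuity equation holds in duality with test functions -/
  pde : ∀ φ : ℝ × Rd d → ℝ, ContDiff ℝ (⊤ : ℕ∞) φ → HasCompactSupport φ →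
    tsupport φ ⊆ Ioo (0 : ℝ) T ×ˢ (univ : Set (Rd d)) →
    ∫ t in Icc (0 : ℝ) T, ∫ x, (deriv (fun s => φ (s, x)) t
      + fderiv ℝ (fun z => φ (t, z)) x (F (μ t) x (y t))) ∂(μ t) = 0
  /-- continuity of the controlled trajectory -/
  yCont : ContinuousOn y (Icc (0 : ℝ) T)
  /-- `y` is a Carathéodory solution of the controlled ODE -/
  ode : ∀ s ∈ Icc (0 : ℝ) T, ∀ t ∈ Icc (0 : ℝ) T,
    y t = y s + ∫ τ in s..t, (G (μ τ) (y τ) + u τ)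

/-- Solution of the Cauchy problem with data `(t₀, μ₀, y₀, u)`. -/
def IsCauchySolution (T : ℝ) (F : Measure (Rd d) → Rd d → Y → Rd d)
    (G : Measure (Rd d) → Y → Y) (u : ℝ → Y) (t₀ : ℝ)
    (μ₀ : Measure (Rd d)) (y₀ : Y) (μ : ℝ → Measure (Rd d)) (y : ℝ → Y) : Prop :=
  IsWeakSolution T F G u μ y ∧ μ t₀ = μ₀ ∧ y t₀ = y₀

/-- Lagrangian (non-local flow) representation for the measure component. -/
structure IsFlowFor (T : ℝ) (F : Measure (Rd d) → Rd d → Y → Rd d) (t₀ : ℝ)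
    (μ₀ : Measure (Rd d)) (μ : ℝ → Measure (Rd d)) (y : ℝ → Y)
    (Φ : ℝ → Rd d → Rd d) : Prop where
  meas : ∀ t ∈ Icc (0 : ℝ) T, Measurable (Φ t)
  init : ∀ x : Rd d, Φ t₀ x = x
  flowOde : ∀ x : Rd d, ∀ t ∈ Icc (0 : ℝ) T,
    Φ t x = x + ∫ s in t₀..t, F (μ s) (Φ s x) (y s)
  push : ∀ t ∈ Icc (0 : ℝ) T, μ t = Measure.map (Φ t) μ₀

end Control

/-- Weak convergence in `L²([0,T], ℝ^c)` of a sequence of controls. -/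
def WeakL2Conv (T : ℝ) (uN : ℕ → ℝ → Rd c) (u : ℝ → Rd c) : Prop :=
  ∀ g : ℝ → Rd c, Measurable g → IntegrableOn (fun t => ‖g t‖ ^ 2) (Icc (0 : ℝ) T) →
    Tendsto (fun N => ∫ t in Icc (0 : ℝ) T, ⟪uN N t, g t⟫) atTop
      (𝓝 (∫ t in Icc (0 : ℝ) T, ⟪u t, g t⟫))

/-! ### Derivative data and the linearized/adjoint systems -/

/-- Collection of the derivatives of the vector fields `F` and `G`:
`DxF`, `DyF` (classical derivatives), `DmuF`, `DmuG` (Wasserstein differentials,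
as matrix fields acting on displacements) and `DyG`. -/
structure DerivData (d c : ℕ) where
  DxF : Measure (Rd d) → Rd d → Rd c → (Rd d →L[ℝ] Rd d)
  DyF : Measure (Rd d) → Rd d → Rd c → (Rd c →L[ℝ] Rd d)
  DmuF : Measure (Rd d) → Rd d → Rd c → Rd d → (Rd d →L[ℝ] Rd d)
  DyG : Measure (Rd d) → Rd c → (Rd c →L[ℝ] Rd c)
  DmuG : Measure (Rd d) → Rd c → Rd d → (Rd d →L[ℝ] Rd c)

/-- Assumptions (H1)–(H2): `F`, `G` are differentiable in `x` and `y` with derivatives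
given by the data `D`, and these derivatives are continuous in all variables
(with respect to `W₂` in the measure variable). -/
def H1H2 (F : Measure (Rd d) → Rd d → Rd c → Rd d) (G : Measure (Rd d) → Rd c → Rd c)
    (D : DerivData d c) : Prop :=
  (∀ μ : Measure (Rd d), IsPc μ → ∀ (x : Rd d) (y : Rd c),
    HasFDerivAt (fun p : Rd d × Rd c => F μ p.1 p.2)
      ((D.DxF μ x y).comp (ContinuousLinearMap.fst ℝ (Rd d) (Rd c))
        + (D.DyF μ x y).comp (ContinuousLinearMap.snd ℝ (Rd d) (Rd c))) (x, y)) ∧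
  (∀ μ : Measure (Rd d), IsPc μ → ∀ y : Rd c, HasFDerivAt (G μ) (D.DyG μ y) y) ∧
  (∀ μ : Measure (Rd d), IsPc μ → ∀ (x : Rd d) (y : Rd c), ∀ ε > (0 : ℝ), ∃ δ > (0 : ℝ),
    ∀ μ' : Measure (Rd d), IsPc μ' → ∀ (x' : Rd d) (y' : Rd c),
      W2 μ μ' + ‖x - x'‖ + ‖y - y'‖ < δ →
      ‖D.DxF μ' x' y' - D.DxF μ x y‖ + ‖D.DyF μ' x' y' - D.DyF μ x y‖ < ε) ∧
  (∀ μ : Measure (Rd d), IsPc μ → ∀ y : Rd c, ∀ ε > (0 : ℝ), ∃ δ > (0 : ℝ),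
    ∀ μ' : Measure (Rd d), IsPc μ' → ∀ y' : Rd c,
      W2 μ μ' + ‖y - y'‖ < δ → ‖D.DyG μ' y' - D.DyG μ y‖ < ε)

/-- Assumption (H3): the maps `μ ↦ F[μ](x,y)` and `μ ↦ G[μ](y)` are Wasserstein
differentiable (componentwise) with differentials given by the data `D`, and these
Wasserstein differentials are continuous in all their variables. -/
def H3 (F : Measure (Rd d) → Rd d → Rd c → Rd d) (G : Measure (Rd d) → Rd c → Rd c)
    (D : DerivData d c) : Prop :=
  (∀ μ : Measure (Rd d), IsPc μ → ∀ (x : Rd d) (y : Rd c) (e : Rd d),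
    HasWGradAt (fun ν => ⟪F ν x y, e⟫) μ
      (fun ζ => ContinuousLinearMap.adjoint (D.DmuF μ x y ζ) e)) ∧
  (∀ μ : Measure (Rd d), IsPc μ → ∀ (y : Rd c) (e : Rd c),
    HasWGradAt (fun ν => ⟪G ν y, e⟫) μ
      (fun ζ => ContinuousLinearMap.adjoint (D.DmuG μ y ζ) e)) ∧
  (∀ μ : Measure (Rd d), IsPc μ → ∀ (x : Rd d) (y : Rd c) (ζ : Rd d), ∀ ε > (0 : ℝ),
    ∃ δ > (0 : ℝ), ∀ μ' : Measure (Rd d), IsPc μ' → ∀ (x' : Rd d) (y' : Rd c) (ζ' : Rd d),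
      W2 μ μ' + ‖x - x'‖ + ‖y - y'‖ + ‖ζ - ζ'‖ < δ →
      ‖D.DmuF μ' x' y' ζ' - D.DmuF μ x y ζ‖ < ε) ∧
  (∀ μ : Measure (Rd d), IsPc μ → ∀ (y : Rd c) (ζ : Rd d), ∀ ε > (0 : ℝ),
    ∃ δ > (0 : ℝ), ∀ μ' : Measure (Rd d), IsPc μ' → ∀ (y' : Rd c) (ζ' : Rd d),
      W2 μ μ' + ‖y - y'‖ + ‖ζ - ζ'‖ < δ → ‖D.DmuG μ' y' ζ' - D.DmuG μ y ζ‖ < ε)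

/-- Reference trajectory data: a Cauchy solution together with its non-local flow. -/
def IsRefSolution (T : ℝ) (F : Measure (Rd d) → Rd d → Rd c → Rd d)
    (G : Measure (Rd d) → Rd c → Rd c) (u : ℝ → Rd c) (t₀ : ℝ)
    (μ₀ : Measure (Rd d)) (y₀ : Rd c) (μs : ℝ → Measure (Rd d)) (ys : ℝ → Rd c)
    (Φ : ℝ → Rd d → Rd d) : Prop :=
  IsCauchySolution T F G u t₀ μ₀ y₀ μs ys ∧ IsFlowFor T F t₀ μ₀ μs ys Φ

/-- The `w`-component of the linearized operator `𝒜(t)`. -/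
def Aw (D : DerivData d c) (μ₀ : Measure (Rd d)) (μs : ℝ → Measure (Rd d))
    (Φ : ℝ → Rd d → Rd d) (ys : ℝ → Rd c) (t : ℝ) (w : Rd d → Rd d) (v : Rd c)
    (x : Rd d) : Rd d :=
  D.DxF (μs t) (Φ t x) (ys t) (w x) + D.DyF (μs t) (Φ t x) (ys t) v
    + ∫ ζ, D.DmuF (μs t) (Φ t x) (ys t) (Φ t ζ) (w ζ) ∂μ₀

/-- The `v`-component of the linearized operator `𝒜(t)`. -/
def Av (D : DerivData d c) (μ₀ : Measure (Rd d)) (μs : ℝ → Measure (Rd d))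
    (Φ : ℝ → Rd d → Rd d) (ys : ℝ → Rd c) (t : ℝ) (w : Rd d → Rd d) (v : Rd c) : Rd c :=
  D.DyG (μs t) (ys t) v + ∫ ζ, D.DmuG (μs t) (ys t) (Φ t ζ) (w ζ) ∂μ₀

/-- Solution (in integral form) of the linearized system
`𝔴̇(t) = 𝒜(t)𝔴(t) + (0, δu(t))`, `𝔴(t₀) = (w₀, v₀)` on `[t₀, T]`. -/
structure IsLinSolution (D : DerivData d c) (μ₀ : Measure (Rd d))
    (μs : ℝ → Measure (Rd d)) (Φ : ℝ → Rd d → Rd d) (ys : ℝ → Rd c) (t₀ T : ℝ)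
    (w₀ : Rd d → Rd d) (v₀ : Rd c) (δu : ℝ → Rd c)
    (w : ℝ → Rd d → Rd d) (v : ℝ → Rd c) : Prop where
  winit : ∀ x, w t₀ x = w₀ x
  vinit : v t₀ = v₀
  weq : ∀ t ∈ Icc t₀ T, ∀ x,
    w t x = w₀ x + ∫ s in t₀..t, Aw D μ₀ μs Φ ys s (w s) (v s) x
  veq : ∀ t ∈ Icc t₀ T,
    v t = v₀ + ∫ s in t₀..t, (Av D μ₀ μs Φ ys s (w s) (v s) + δu s)

/-- The `p`-component of the adjoint operator `𝒜(t)*`. -/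
def AwStar (D : DerivData d c) (μ₀ : Measure (Rd d)) (μs : ℝ → Measure (Rd d))
    (Φ : ℝ → Rd d → Rd d) (ys : ℝ → Rd c) (t : ℝ) (p : Rd d → Rd d) (q : Rd c)
    (x : Rd d) : Rd d :=
  ContinuousLinearMap.adjoint (D.DxF (μs t) (Φ t x) (ys t)) (p x)
    + ContinuousLinearMap.adjoint (D.DmuG (μs t) (ys t) (Φ t x)) q
    + ∫ ζ, ContinuousLinearMap.adjoint (D.DmuF (μs t) (Φ t ζ) (ys t) (Φ t x)) (p ζ) ∂μ₀

/-- The `q`-component of the adjoint operator `𝒜(t)*`. -/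
def AvStar (D : DerivData d c) (μ₀ : Measure (Rd d)) (μs : ℝ → Measure (Rd d))
    (Φ : ℝ → Rd d → Rd d) (ys : ℝ → Rd c) (t : ℝ) (p : Rd d → Rd d) (q : Rd c) : Rd c :=
  (∫ ζ, ContinuousLinearMap.adjoint (D.DyF (μs t) (Φ t ζ) (ys t)) (p ζ) ∂μ₀)
    + ContinuousLinearMap.adjoint (D.DyG (μs t) (ys t)) q

/-- Solution (in integral form) of the backward adjoint equation
`−𝔭̇(t) = 𝒜(t)* 𝔭(t)` on `[τ, T]` with terminal condition `(pT, qT)`. -/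
structure IsAdjointSolution (D : DerivData d c) (μ₀ : Measure (Rd d))
    (μs : ℝ → Measure (Rd d)) (Φ : ℝ → Rd d → Rd d) (ys : ℝ → Rd c) (τ T : ℝ)
    (pT : Rd d → Rd d) (qT : Rd c) (p : ℝ → Rd d → Rd d) (q : ℝ → Rd c) : Prop where
  pterm : ∀ x, p T x = pT x
  qterm : q T = qT
  peq : ∀ t ∈ Icc τ T, ∀ x,
    p t x = pT x + ∫ s in t..T, AwStar D μ₀ μs Φ ys s (p s) (q s) x
  qeq : ∀ t ∈ Icc τ T,
    q t = qT + ∫ s in t..T, AvStar D μ₀ μs Φ ys s (p s) (q s)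

end WC

namespace WC

variable {n : ℕ}

lemma transportCost_nonneg (γ : Measure (Rd n × Rd n)) : 0 ≤ transportCost γ :=
  Real.sqrt_nonneg _

lemma transportCost_sq (γ : Measure (Rd n × Rd n)) :
    transportCost γ ^ 2 = ∫ p, ‖p.1 - p.2‖ ^ 2 ∂γ :=
  Real.sq_sqrt (integral_nonneg fun _ => by positivity)

lemma W2_nonneg (μ ν : Measure (Rd n)) : 0 ≤ W2 μ ν := by
  refine Real.sInf_nonneg ?_
  rintro r ⟨γ, -, rfl⟩
  exact transportCost_nonneg γ

lemma IsCoupling.W2_le {γ : Measure (Rd n × Rd n)} {μ ν : Measure (Rd n)}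
    (h : IsCoupling γ μ ν) : W2 μ ν ≤ transportCost γ := by
  refine csInf_le ⟨0, ?_⟩ ⟨γ, h, rfl⟩
  rintro r ⟨γ', -, rfl⟩
  exact transportCost_nonneg γ'

/-- Continuous functions are integrable against finite measures concentrated on a compact set. -/
lemma integrable_of_compact_compl_null {X F : Type*} [TopologicalSpace X] [T2Space X]
    [MeasurableSpace X] [OpensMeasurableSpace X] [NormedAddCommGroup F]
    [SecondCountableTopologyEither X F] {μ : Measure X} [IsFiniteMeasure μ] {K : Set X}
    (hK : IsCompact K) (hμK : μ Kᶜ = 0) {f : X → F} (hf : Continuous f) : Integrable f μ := by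
  have h := hf.continuousOn.integrableOn_of_subset_isCompact (μ := μ) hK hK.measurableSet
    Subset.rfl (measure_ne_top μ K)
  rwa [IntegrableOn, Measure.restrict_eq_self_of_ae_mem] at h
  exact measure_eq_zero_iff_ae_notMem.1 hμK |>.mono fun x hx => by simpa using hx

lemma IsPc.isP2 {μ : Measure (Rd n)} (h : IsPc μ) : IsP2 μ := by
  obtain ⟨hp, R, hR⟩ := h
  exact ⟨hp, integrable_of_compact_compl_null (isCompact_closedBall 0 R) hR (by fun_prop)⟩

lemma IsCoupling.isProbabilityMeasure {γ : Measure (Rd n × Rd n)} {μ ν : Measure (Rd n)}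
    (h : IsCoupling γ μ ν) [IsProbabilityMeasure μ] : IsProbabilityMeasure γ := by
  constructor
  rw [← Measure.fst_univ, h.1, measure_univ]

lemma IsCoupling.compl_prod_null {γ : Measure (Rd n × Rd n)} {μ ν : Measure (Rd n)}
    (h : IsCoupling γ μ ν) {K L : Set (Rd n)} (hK : MeasurableSet K) (hL : MeasurableSet L)
    (hμ : μ Kᶜ = 0) (hν : ν Lᶜ = 0) : γ (K ×ˢ L)ᶜ = 0 := by
  rw [← h.1, Measure.fst_apply hK.compl] at hμ
  rw [← h.2, Measure.snd_apply hL.compl] at hν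
  refine measure_mono_null ?_ (measure_union_null hμ hν)
  rintro ⟨x, y⟩ hxy
  simp only [mem_compl_iff, mem_prod, not_and_or] at hxy
  simpa using hxy

lemma IsCoupling.integrable {γ : Measure (Rd n × Rd n)} {μ ν : Measure (Rd n)}
    (h : IsCoupling γ μ ν) (hμ : IsPc μ) (hν : IsPc ν) {F : Type*} [NormedAddCommGroup F]
    {f : Rd n × Rd n → F} (hf : Continuous f) : Integrable f γ := by
  obtain ⟨hp, R, hR⟩ := hμ
  obtain ⟨-, S, hS⟩ := hν
  have := h.isProbabilityMeasure
  exact integrable_of_compact_compl_null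
    ((isCompact_closedBall 0 R).prod (isCompact_closedBall 0 S))
    (h.compl_prod_null measurableSet_closedBall measurableSet_closedBall hR hS) hf

/-- Existence of optimal couplings between compactly supported probability measures. -/
lemma exists_isOptCoupling {μ ν : Measure (Rd n)} (hμ : IsPc μ) (hν : IsPc ν) :
    ∃ γ, IsOptCoupling γ μ ν := by
  obtain ⟨hμp, R, hR⟩ := id hμ
  obtain ⟨hνp, S, hS⟩ := id hν
  set K : Set (Rd n × Rd n) := closedBall 0 R ×ˢ closedBall 0 S
  have hK : IsCompact K := (isCompact_closedBall 0 R).prod (isCompact_closedBall 0 S)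
  let C : Set (ProbabilityMeasure (Rd n × Rd n)) := {γ | IsCoupling (γ : Measure _) μ ν}
  have hCK : ∀ γ ∈ C, (γ : Measure (Rd n × Rd n)) Kᶜ = 0 := fun γ hγ =>
    hγ.compl_prod_null measurableSet_closedBall measurableSet_closedBall hR hS
  have hCclosed : IsClosed C := by
    have : C = (fun γ => γ.map (f := Prod.fst) measurable_fst.aemeasurable) ⁻¹' {⟨μ, hμp⟩} ∩
        (fun γ => γ.map (f := Prod.snd) measurable_snd.aemeasurable) ⁻¹' {⟨ν, hνp⟩} := by
      ext γ
      have h₁ : γ.map (f := Prod.fst) measurable_fst.aemeasurable = ⟨μ, hμp⟩ ↔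
          (γ : Measure (Rd n × Rd n)).fst = μ := Subtype.ext_iff
      have h₂ : γ.map (f := Prod.snd) measurable_snd.aemeasurable = ⟨ν, hνp⟩ ↔
          (γ : Measure (Rd n × Rd n)).snd = ν := Subtype.ext_iff
      exact (and_congr h₁ h₂).symm
    rw [this]
    exact (isClosed_singleton.preimage (ProbabilityMeasure.continuous_map continuous_fst)).inter
      (isClosed_singleton.preimage (ProbabilityMeasure.continuous_map continuous_snd))
  have hCcompact : IsCompact C := by
    refine (isCompact_setOfPred_probabilityMeasure_mass_eq_compl_isCompact_le
      (u := fun _ => 0) (K := fun _ => K) tendsto_const_nhds (fun _ => hK)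
      (Or.inr monotone_const)).of_isClosed_subset hCclosed ?_
    intro γ hγ _
    have := hCK γ hγ
    simp [ProbabilityMeasure.null_iff_toMeasure_null, this]
  have hCne : C.Nonempty := ⟨⟨μ.prod ν, inferInstance⟩, Measure.fst_prod, Measure.snd_prod⟩
  obtain ⟨M, hM⟩ := hK.exists_bound_of_continuousOn
    (f := fun p : Rd n × Rd n => ‖p.1 - p.2‖ ^ 2) (by fun_prop)
  let f : BoundedContinuousFunction (Rd n × Rd n) ℝ :=
    BoundedContinuousFunction.ofNormedAddCommGroup (fun p => min (‖p.1 - p.2‖ ^ 2) |M|)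
      (by fun_prop) |M| (fun p => by
        rw [Real.norm_of_nonneg (by positivity)]
        exact min_le_right _ _)
  have hf : ∀ γ ∈ C, ∫ p, f p ∂(γ : Measure (Rd n × Rd n)) =
      transportCost (γ : Measure (Rd n × Rd n)) ^ 2 := by
    intro γ hγ
    rw [transportCost_sq]
    refine integral_congr_ae ?_
    filter_upwards [measure_eq_zero_iff_ae_notMem.1 (hCK γ hγ)] with p hp
    have := hM p (by simpa using hp)
    rw [Real.norm_of_nonneg (by positivity)] at this
    exact min_eq_left (this.trans (le_abs_self M))
  obtain ⟨γ, hγ, hmin⟩ := hCcompact.exists_isMinOn hCne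
    (ProbabilityMeasure.continuous_integral_boundedContinuousFunction f).continuousOn
  refine ⟨γ, hγ, le_antisymm (le_csInf ⟨_, γ, hγ, rfl⟩ ?_) (IsCoupling.W2_le hγ)⟩
  rintro r ⟨γ', hγ', rfl⟩
  have hp := hγ'.isProbabilityMeasure
  have h := (hf γ hγ).symm.trans_le
    ((isMinOn_iff.1 hmin ⟨γ', hp⟩ hγ').trans_eq (hf ⟨γ', hp⟩ hγ'))
  exact (sq_le_sq₀ (transportCost_nonneg _) (transportCost_nonneg _)).1 h

/-- Quadratic Taylor bound for smooth compactly supported functions. -/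
lemma exists_taylor_bound {ψ : Rd n → ℝ} (hψ : ContDiff ℝ (⊤ : ℕ∞) ψ)
    (hψc : HasCompactSupport ψ) :
    ∃ M : ℝ, 0 ≤ M ∧ ∀ x y, |ψ y - ψ x - ⟪gradient ψ x, y - x⟫| ≤ M * ‖x - y‖ ^ 2 := by
  obtain ⟨L, hL⟩ := (hψ.fderiv_right (m := 1) (by norm_cast)).lipschitzWith_of_hasCompactSupport
    (hψc.fderiv (𝕜 := ℝ)) one_ne_zero
  refine ⟨L, L.2, fun x y => ?_⟩
  have h := (convex_segment x y).norm_image_sub_le_of_norm_fderiv_le' (f := ψ)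
    (φ := fderiv ℝ ψ x) (C := L * ‖x - y‖)
    (fun z _ => hψ.differentiable (by simp) z) (fun z hz => ?_)
    (left_mem_segment ℝ x y) (right_mem_segment ℝ x y)
  · rw [gradient, InnerProductSpace.toDual_symm_apply]
    rw [norm_sub_rev y x, Real.norm_eq_abs] at h
    exact h.trans_eq (by ring)
  · refine (hL.norm_sub_le z x).trans ?_
    gcongr
    rw [norm_sub_rev x y]
    exact norm_sub_le_of_mem_segment hz

/-- Pairing a continuous field with the displacement of a coupling, compared with the variation
of the mean of a potential. -/
lemma IsCoupling.abs_integral_inner_sub_le {γ : Measure (Rd n × Rd n)} {μ ν : Measure (Rd n)}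
    (hγ : IsCoupling γ μ ν) (hμ : IsPc μ) (hν : IsPc ν) {ξ : Rd n → Rd n} (hξ : Continuous ξ)
    {ψ : Rd n → ℝ} (hψ : ContDiff ℝ (⊤ : ℕ∞) ψ) {M : ℝ} (hM0 : 0 ≤ M)
    (hM : ∀ x y, |ψ y - ψ x - ⟪gradient ψ x, y - x⟫| ≤ M * ‖x - y‖ ^ 2)
    {ε h : ℝ} (hε : 0 < ε) (hh : 0 < h) (hξψ : ∫ x, ‖ξ x - gradient ψ x‖ ^ 2 ∂μ ≤ ε ^ 2)
    (hγh : transportCost γ ≤ h) :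
    |∫ p, ⟪ξ p.1, p.2 - p.1⟫ ∂γ - (∫ y, ψ y ∂ν - ∫ x, ψ x ∂μ)| ≤ ε * h + M * h ^ 2 := by
  have hgrad : Continuous (gradient ψ) :=
    (InnerProductSpace.toDual ℝ (Rd n)).symm.continuous.comp
      (hψ.continuous_fderiv (by simp))
  have hψcont := hψ.continuous
  have hint {F : Type} [NormedAddCommGroup F] {f : Rd n × Rd n → F} (hf : Continuous f) :
      Integrable f γ := hγ.integrable hμ hν hf
  have h1 : ∫ x, ψ x ∂μ = ∫ p, ψ p.1 ∂γ := by
    rw [← hγ.1, Measure.fst, integral_map measurable_fst.aemeasurable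
      hψcont.aestronglyMeasurable]
  have h2 : ∫ y, ψ y ∂ν = ∫ p, ψ p.2 ∂γ := by
    rw [← hγ.2, Measure.snd, integral_map measurable_snd.aemeasurable
      hψcont.aestronglyMeasurable]
  have h3 : ∫ x, ‖ξ x - gradient ψ x‖ ^ 2 ∂μ = ∫ p, ‖ξ p.1 - gradient ψ p.1‖ ^ 2 ∂γ := by
    rw [← hγ.1, Measure.fst, integral_map measurable_fst.aemeasurable
      (by fun_prop)]
  rw [h1, h2, ← integral_sub (hint (by fun_prop)) (hint (by fun_prop)),
    ← integral_sub (hint (by fun_prop)) (hint (by fun_prop))]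
  have hcost : ∫ p, ‖p.1 - p.2‖ ^ 2 ∂γ ≤ h ^ 2 := by
    rw [← transportCost_sq]
    exact pow_le_pow_left₀ (transportCost_nonneg γ) hγh 2
  calc |∫ p, (⟪ξ p.1, p.2 - p.1⟫ - (ψ p.2 - ψ p.1)) ∂γ|
      ≤ ∫ p, |⟪ξ p.1, p.2 - p.1⟫ - (ψ p.2 - ψ p.1)| ∂γ := abs_integral_le_integral_abs
    _ ≤ ∫ p, (h / (2 * ε) * ‖ξ p.1 - gradient ψ p.1‖ ^ 2
          + (ε / (2 * h) + M) * ‖p.1 - p.2‖ ^ 2) ∂γ := by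
        refine integral_mono (hint (by fun_prop)) (hint (by fun_prop)) fun p => ?_
        have e : ⟪ξ p.1, p.2 - p.1⟫ - (ψ p.2 - ψ p.1)
            = ⟪ξ p.1 - gradient ψ p.1, p.2 - p.1⟫
              - (ψ p.2 - ψ p.1 - ⟪gradient ψ p.1, p.2 - p.1⟫) := by
          rw [inner_sub_left]; ring
        have i1 := abs_real_inner_le_norm (ξ p.1 - gradient ψ p.1) (p.2 - p.1)
        rw [norm_sub_rev p.2 p.1] at i1
        have i2 : ‖ξ p.1 - gradient ψ p.1‖ * ‖p.1 - p.2‖ ≤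
            h / (2 * ε) * ‖ξ p.1 - gradient ψ p.1‖ ^ 2 + ε / (2 * h) * ‖p.1 - p.2‖ ^ 2 := by
          set a := ‖ξ p.1 - gradient ψ p.1‖
          set b := ‖p.1 - p.2‖
          have : h / (2 * ε) * a ^ 2 + ε / (2 * h) * b ^ 2 - a * b
              = (h * a - ε * b) ^ 2 / (2 * ε * h) := by
            field_simp
            ring
          have : 0 ≤ (h * a - ε * b) ^ 2 / (2 * ε * h) := by positivity
          linarith
        have i3 := hM p.1 p.2
        simp only [e]
        refine (abs_sub _ _).trans ?_
        linarith
    _ = h / (2 * ε) * ∫ p, ‖ξ p.1 - gradient ψ p.1‖ ^ 2 ∂γ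
          + (ε / (2 * h) + M) * ∫ p, ‖p.1 - p.2‖ ^ 2 ∂γ := by
        rw [integral_add (hint (by fun_prop)) (hint (by fun_prop)), integral_const_mul,
          integral_const_mul]
    _ ≤ h / (2 * ε) * ε ^ 2 + (ε / (2 * h) + M) * h ^ 2 := by
        rw [h3] at hξψ
        gcongr
    _ = ε * h + M * h ^ 2 := by
        field_simp
        ring

/-- Continuous Wasserstein gradients at compactly supported measures are strong: the first-order
expansion holds along arbitrary couplings. -/
lemma HasWGradAt.strong {φ : Measure (Rd n) → ℝ} {μ : Measure (Rd n)} {ξ : Rd n → Rd n}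
    (hφ : HasWGradAt φ μ ξ) (hμ : IsPc μ) (hξ : Continuous ξ) {ε : ℝ} (hε : 0 < ε) :
    ∃ δ > (0 : ℝ), ∀ ν, IsPc ν → ∀ γ, IsCoupling γ μ ν → ∀ h : ℝ, 0 < h → h < δ →
      transportCost γ ≤ h → |φ ν - φ μ - ∫ p, ⟪ξ p.1, p.2 - p.1⟫ ∂γ| ≤ ε * h := by
  obtain ⟨ψ, hψ, hψc, hξψ⟩ := hφ.1 ((ε / 6) ^ 2) (by positivity)
  obtain ⟨M, hM0, hM⟩ := exists_taylor_bound hψ hψc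
  obtain ⟨δ, hδ, hexp⟩ := hφ.2 (ε / 3) (by positivity)
  refine ⟨min δ (ε / (6 * (M + 1))), by positivity, fun ν hν γ hγ h hh hhδ hγh => ?_⟩
  obtain ⟨γ', hγ'⟩ := exists_isOptCoupling hμ hν
  have hW : W2 μ ν ≤ h := hγ.W2_le.trans hγh
  have e0 := hexp ν hν.isP2 γ' hγ' (hW.trans_lt (hhδ.trans_le (min_le_left _ _)))
  have e1 := hγ.abs_integral_inner_sub_le hμ hν hξ hψ hM0 hM (ε := ε / 6) (by positivity) hh
    hξψ.le hγh
  have e2 := hγ'.1.abs_integral_inner_sub_le hμ hν hξ hψ hM0 hM (ε := ε / 6) (by positivity) hh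
    hξψ.le (hγ'.2.trans_le hW)
  have hMh : M * h ^ 2 ≤ ε / 6 * h := by
    have : h * (6 * (M + 1)) < ε :=
      (lt_div_iff₀ (by positivity)).1 (hhδ.trans_le (min_le_right _ _))
    nlinarith
  have e3 : ε / 3 * W2 μ ν ≤ ε / 3 * h := by gcongr
  rw [abs_le] at e0 e1 e2 ⊢
  constructor <;> linarith

/-- The coupling of `(Id + θ w)_# μ` and `(Id + θ' w)_# μ` induced by the interpolation. -/
lemma isCoupling_map_interpolation (μ : Measure (Rd n)) {w : Rd n → Rd n} (hw : Measurable w)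
    (θ θ' : ℝ) :
    IsCoupling (μ.map fun x => (x + θ • w x, x + θ' • w x))
      (μ.map fun x => x + θ • w x) (μ.map fun x => x + θ' • w x) := by
  constructor
  · exact Measure.fst_map_prodMk (by fun_prop)
  · exact Measure.snd_map_prodMk (by fun_prop)

lemma transportCost_map_interpolation_le (μ : Measure (Rd n)) [IsProbabilityMeasure μ]
    {w : Rd n → Rd n} (hw : Measurable w) {B : ℝ} (hB : ∀ x, ‖w x‖ ≤ B) (θ θ' : ℝ) :
    transportCost (μ.map fun x => (x + θ • w x, x + θ' • w x)) ≤ |θ' - θ| * B := by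
  have hB0 : 0 ≤ B := (norm_nonneg _).trans (hB 0)
  rw [transportCost, integral_map (by fun_prop)
    (Continuous.aestronglyMeasurable (by fun_prop))]
  refine Real.sqrt_le_iff.2 ⟨by positivity, ?_⟩
  have hle : ∀ x, ‖(x + θ • w x) - (x + θ' • w x)‖ ^ 2 ≤ (|θ' - θ| * B) ^ 2 := by
    intro x
    have : (x + θ • w x) - (x + θ' • w x) = (θ - θ') • w x := by
      rw [sub_smul]; abel
    rw [this, norm_smul, Real.norm_eq_abs, abs_sub_comm]
    gcongr
    exact hB x
  refine (integral_mono_of_nonneg (.of_forall fun x => by positivity)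
    (integrable_const ((|θ' - θ| * B) ^ 2)) (.of_forall hle)).trans ?_
  simp

lemma IsPc.map_interpolation {μ : Measure (Rd n)} (hμ : IsPc μ) {w : Rd n → Rd n}
    (hw : Measurable w) {B : ℝ} (hB : ∀ x, ‖w x‖ ≤ B) (θ : ℝ) :
    IsPc (μ.map fun x => x + θ • w x) := by
  obtain ⟨hp, R, hR⟩ := hμ
  have hm : Measurable fun x => x + θ • w x := by fun_prop
  refine ⟨Measure.isProbabilityMeasure_map hm.aemeasurable, R + |θ| * B, ?_⟩
  rw [Measure.map_apply hm measurableSet_closedBall.compl]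
  rw [preimage_compl]
  refine measure_mono_null (t := (closedBall 0 R)ᶜ) (compl_subset_compl.2 fun x hxR => ?_) hR
  rw [mem_preimage, mem_closedBall_zero_iff]
  rw [mem_closedBall_zero_iff] at hxR
  refine (norm_add_le _ _).trans ?_
  rw [norm_smul, Real.norm_eq_abs]
  gcongr
  exact hB x

end WC

/-- Smoothness along transport interpolations.
Let `φ : P₂(ℝ^d) → ℝ` be Wasserstein differentiable at every measure with gradient
field `Dφ`, with `(μ,ζ) ↦ Dφ[μ](ζ)` continuous, `μ* ∈ P_c(ℝ^d)`,
`w ∈ L^∞(ℝ^d,ℝ^d;μ*)`, and `μ^θ = (Id + θw)_#μ*`. Then `Φ(θ) := φ(μ^θ)` is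
continuously differentiable on `[0,1]` with
`Φ'(θ) = ∫ Dφ[μ^θ](ζ + θw(ζ)) · w(ζ) dμ*(ζ)`. -/
theorem smoothness_along_transport_interpolations {d : ℕ}
    (φ : Measure (Rd d) → ℝ) (Dφ : Measure (Rd d) → Rd d → Rd d)
    (hdiff : ∀ μ : Measure (Rd d), WC.IsP2 μ → WC.HasWGradAt φ μ (Dφ μ))
    (hcont : ∀ (μ : Measure (Rd d)) (ζ : Rd d), WC.IsP2 μ → ∀ ε > (0 : ℝ),
      ∃ δ > (0 : ℝ), ∀ (μ' : Measure (Rd d)) (ζ' : Rd d), WC.IsP2 μ' →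
        WC.W2 μ μ' + ‖ζ - ζ'‖ < δ → ‖Dφ μ' ζ' - Dφ μ ζ‖ < ε)
    (μstar : Measure (Rd d)) (hμstar : WC.IsPc μstar)
    (w : Rd d → Rd d) (hwm : Measurable w) (hwb : WC.BddFun w) :
    (∀ θ ∈ Icc (0 : ℝ) 1,
      HasDerivWithinAt (fun θ' : ℝ => φ (Measure.map (fun x => x + θ' • w x) μstar))
        (∫ ζ, ⟪Dφ (Measure.map (fun x => x + θ • w x) μstar) (ζ + θ • w ζ), w ζ⟫ ∂μstar)
        (Icc (0 : ℝ) 1) θ) ∧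
    ContinuousOn
      (fun θ : ℝ =>
        ∫ ζ, ⟪Dφ (Measure.map (fun x => x + θ • w x) μstar) (ζ + θ • w ζ), w ζ⟫ ∂μstar)
      (Icc (0 : ℝ) 1) := by
  obtain ⟨B₀, hB₀⟩ := hwb
  obtain ⟨B, hBpos, hB⟩ : ∃ B : ℝ, 0 < B ∧ ∀ x, ‖w x‖ ≤ B :=
    ⟨|B₀| + 1, by positivity, fun x => (hB₀ x).trans (by linarith [le_abs_self B₀])⟩
  have hprob : IsProbabilityMeasure μstar := hμstar.1
  set m : ℝ → Measure (Rd d) := fun θ => Measure.map (fun x => x + θ • w x) μstar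
  have hPc : ∀ θ, WC.IsPc (m θ) := hμstar.map_interpolation hwm hB
  have hjoint : Continuous fun q : ℝ × Rd d => Dφ (m q.1) q.2 := by
    rw [Metric.continuous_iff]
    rintro ⟨θ, z⟩ ε hε
    obtain ⟨δ, hδ, h⟩ := hcont (m θ) z (hPc θ).isP2 ε hε
    refine ⟨δ / (B + 1), by positivity, ?_⟩
    rintro ⟨θ', z'⟩ hq
    rw [dist_eq_norm]
    refine h (m θ') z' (hPc θ').isP2 ?_
    rw [Prod.dist_eq, max_lt_iff, Real.dist_eq, dist_eq_norm, norm_sub_rev,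
      lt_div_iff₀ (by positivity), lt_div_iff₀ (by positivity)] at hq
    have hW : WC.W2 (m θ) (m θ') ≤ |θ' - θ| * B :=
      (WC.isCoupling_map_interpolation μstar hwm θ θ').W2_le.trans
        (WC.transportCost_map_interpolation_le μstar hwm hB θ θ')
    have h1 : WC.W2 (m θ) (m θ') * (B + 1) ≤ (|θ' - θ| * (B + 1)) * B := by
      calc _ ≤ (|θ' - θ| * B) * (B + 1) := by gcongr
        _ = _ := by ring
    have h2 : (|θ' - θ| * (B + 1)) * B < δ * B := by
      gcongr
      exact hq.1
    have h3 : (WC.W2 (m θ) (m θ') + ‖z - z'‖) * (B + 1) < δ * (B + 1) := by linarith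
    exact lt_of_mul_lt_mul_right h3 (by positivity)
  have hDcont : ∀ θ, Continuous (Dφ (m θ)) := fun θ =>
    hjoint.comp (Continuous.prodMk_right θ)
  refine ⟨fun θ _ => HasDerivAt.hasDerivWithinAt ?_, Continuous.continuousOn ?_⟩
  · rw [hasDerivAt_iff_isLittleO, Asymptotics.isLittleO_iff]
    intro c hc
    obtain ⟨δ, hδ, h⟩ := (hdiff (m θ) (hPc θ).isP2).strong (hPc θ) (hDcont θ)
      (ε := c / B) (by positivity)
    filter_upwards [Metric.ball_mem_nhds θ (show 0 < δ / B by positivity)] with θ' hθ'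
    rcases eq_or_ne θ' θ with rfl | hne
    · simp
    rw [Metric.mem_ball, Real.dist_eq, lt_div_iff₀ hBpos] at hθ'
    have hpos : 0 < |θ' - θ| * B := mul_pos (abs_pos.2 (sub_ne_zero.2 hne)) hBpos
    have key := h (m θ') (hPc θ') _ (WC.isCoupling_map_interpolation μstar hwm θ θ')
      (|θ' - θ| * B) hpos hθ' (WC.transportCost_map_interpolation_le μstar hwm hB θ θ')
    have hDθ := hDcont θ
    rw [integral_map (by fun_prop) (Continuous.aestronglyMeasurable (by fun_prop))] at key
    have hint : ∫ x, ⟪Dφ (m θ) (x + θ • w x), (x + θ' • w x) - (x + θ • w x)⟫ ∂μstar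
        = (θ' - θ) • ∫ x, ⟪Dφ (m θ) (x + θ • w x), w x⟫ ∂μstar := by
      rw [← integral_smul]
      congr 1 with x
      rw [add_sub_add_left_eq_sub, ← sub_smul, inner_smul_right, smul_eq_mul]
    rw [hint] at key
    rw [Real.norm_eq_abs, Real.norm_eq_abs]
    refine key.trans_eq ?_
    field_simp
  · obtain ⟨R, hR⟩ := hμstar.2
    rw [continuous_iff_continuousAt]
    intro θ
    have hK : IsCompact (closedBall θ 1 ×ˢ closedBall (0 : Rd d) (R + (|θ| + 1) * B)) :=
      (isCompact_closedBall _ _).prod (isCompact_closedBall _ _)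
    obtain ⟨C, hC⟩ := hK.exists_bound_of_continuousOn hjoint.continuousOn
    refine continuousAt_of_dominated (bound := fun _ => C * B) ?_ ?_ (integrable_const _) ?_
    · refine .of_forall fun θ' => Measurable.aestronglyMeasurable ?_
      have := (hDcont θ').measurable
      fun_prop
    · filter_upwards [Metric.closedBall_mem_nhds θ one_pos] with θ' hθ'
      filter_upwards [measure_eq_zero_iff_ae_notMem.1 hR] with x hx
      have hx : ‖x‖ ≤ R := by simpa using hx
      have hθ'' : |θ'| ≤ |θ| + 1 := by
        rw [mem_closedBall, Real.dist_eq] at hθ'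
        linarith [abs_sub_abs_le_abs_sub θ' θ]
      have hmem : (θ', x + θ' • w x) ∈
          closedBall θ 1 ×ˢ closedBall (0 : Rd d) (R + (|θ| + 1) * B) := by
        refine ⟨hθ', mem_closedBall_zero_iff.2 ((norm_add_le _ _).trans ?_)⟩
        rw [norm_smul, Real.norm_eq_abs]
        gcongr
        exact hB x
      have hCx := hC _ hmem
      refine (norm_inner_le_norm _ _).trans ?_
      exact mul_le_mul hCx (hB x) (norm_nonneg _) ((norm_nonneg _).trans hCx)
    · refine .of_forall fun x => Continuous.continuousAt ?_
      have : Continuous fun θ' : ℝ => Dφ (m θ') (x + θ' • w x) :=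
        hjoint.comp (f := fun θ' : ℝ => (θ', x + θ' • w x)) (by fun_prop)
      exact this.inner continuous_const
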